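/- Let T1 and T2 be first-order theories (in effectively presented languages) each extending the theory of dense linear orders without endpoints, such that the only symbols common to their languages are < and =. If the universal fragments of T1 and T2 are decidable, then the universal fragment of T1 ∪ T2 is also decidable. -/

import Mathlib

namespace Paper

open FirstOrder Language

section Encoding

variable {L : Language} [∀ n, Encodable (L.Functions n)] [∀ n, Encodable (L.Relations n)]

/-- A canonical encoding of sentences, derived from Mathlib's list encoding of
bounded formulas. -/
instance sentenceEncodable : Encodable L.Sentence :=
  Encodable.ofLeftInjection
    (fun φ => BoundedFormula.listEncode φ)
    (fun l => (BoundedFormula.listDecode l)[0]?.bind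
      (fun ψ => if h : ψ.1 = 0 then some (cast (by rw [h]) ψ.2) else none))
    (fun φ => by
      have h := BoundedFormula.listDecode_encode_list (L := L) (α := Empty) [⟨0, φ⟩]
      simp only [List.flatMap_singleton] at h
      simp [h])

end Encoding

/-- A sentence is universal if it is of the form `∀ x₁ … ∀ xₙ ψ` with `ψ` quantifier-free. -/
def IsUniversalSentence {L : Language} (φ : L.Sentence) : Prop :=
  ∃ (n : ℕ) (ψ : L.BoundedFormula Empty n), ψ.IsQF ∧ φ = ψ.alls

/-- The universal fragment of a theory: the set of universal sentences it proves
(equivalently, by the Gödel completeness theorem, its universal semantic consequences). -/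
def univFragment {L : Language} (T : L.Theory) : Set L.Sentence :=
  {φ | IsUniversalSentence φ ∧ T ⊨ᵇ φ}

/-- A set of objects with a canonical encoding is decidable if some computable function
decides membership via codes. -/
def DecidableVia {α : Type} [Encodable α] (S : Set α) : Prop :=
  ∃ f : ℕ → Bool, Computable f ∧ ∀ a : α, a ∈ S ↔ f (Encodable.encode a) = true

end Paper
namespace Paper

open FirstOrder Language

/-- The language of orders: a single binary relation `<`. -/
@[reducible] def ordLang : Language where
  Functions := fun _ => Empty
  Relations
    | 2 => Unit
    | _ => Empty

/-- The formula `s < t` of the order language. -/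
def oLt {k : ℕ} (s t : ordLang.Term (Empty ⊕ Fin k)) : ordLang.BoundedFormula Empty k :=
  Relations.boundedFormula₂ ((() : Unit) : ordLang.Relations 2) s t

/-- The theory of dense linear orders without endpoints, in the language with `<` (and `=`). -/
def dloTheory : ordLang.Theory :=
  { ∀' ∼(oLt &0 &0),
    ∀' ∀' ∀' (oLt &0 &1 ⟹ oLt &1 &2 ⟹ oLt &0 &2),
    ∀' ∀' (oLt &0 &1 ⊔ (&0 =' &1) ⊔ oLt &1 &0),
    ∀' ∀' (oLt &0 &1 ⟹ ∃' (oLt &0 &2 ⊓ oLt &2 &1)),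
    ∀' ∃' (oLt &1 &0),
    ∀' ∃' (oLt &0 &1) }

instance ordFunctionsEncodable : ∀ n, Encodable (ordLang.Functions n) := fun _ =>
  inferInstanceAs (Encodable Empty)

instance ordRelationsEncodable : ∀ n, Encodable (ordLang.Relations n)
  | 0 => inferInstanceAs (Encodable Empty)
  | 1 => inferInstanceAs (Encodable Empty)
  | 2 => inferInstanceAs (Encodable Unit)
  | _ + 3 => inferInstanceAs (Encodable Empty)

section

variable (L₁' L₂' : Language)
  [∀ n, Encodable (L₁'.Functions n)] [∀ n, Encodable (L₁'.Relations n)]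
  [∀ n, Encodable (L₂'.Functions n)] [∀ n, Encodable (L₂'.Relations n)]

instance sumFunctionsEncodable (L₁ L₂ : Language)
    [∀ n, Encodable (L₁.Functions n)] [∀ n, Encodable (L₂.Functions n)] :
    ∀ n, Encodable ((L₁.sum L₂).Functions n) := fun n =>
  inferInstanceAs (Encodable (L₁.Functions n ⊕ L₂.Functions n))

instance sumRelationsEncodable (L₁ L₂ : Language)
    [∀ n, Encodable (L₁.Relations n)] [∀ n, Encodable (L₂.Relations n)] :
    ∀ n, Encodable ((L₁.sum L₂).Relations n) := fun n =>
  inferInstanceAs (Encodable (L₁.Relations n ⊕ L₂.Relations n))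

section

open FirstOrder Language Encodable

attribute [fun_prop] Primrec

section prim
variable {α β γ σ : Type} [Primcodable α] [Primcodable β] [Primcodable γ] [Primcodable σ]

@[fun_prop] theorem pr_id : Primrec (fun a : α => a) := Primrec.id
@[fun_prop] theorem pr_const (b : β) : Primrec (fun _ : α => b) := Primrec.const b
@[fun_prop] theorem pr_comp {f : β → γ} {g : α → β} (hf : Primrec f) (hg : Primrec g) :
    Primrec (fun a => f (g a)) := hf.comp hg
@[fun_prop] theorem pr_pair {f : α → β} {g : α → γ} (hf : Primrec f) (hg : Primrec g) :
    Primrec (fun a => (f a, g a)) := hf.pair hg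
@[fun_prop] theorem pr_fst {f : α → β × γ} (hf : Primrec f) : Primrec (fun a => (f a).1) :=
  Primrec.fst.comp hf
@[fun_prop] theorem pr_snd {f : α → β × γ} (hf : Primrec f) : Primrec (fun a => (f a).2) :=
  Primrec.snd.comp hf
@[fun_prop] theorem pr_add {f g : α → ℕ} (hf : Primrec f) (hg : Primrec g) :
    Primrec (fun a => f a + g a) := Primrec.nat_add.comp hf hg
@[fun_prop] theorem pr_mul {f g : α → ℕ} (hf : Primrec f) (hg : Primrec g) :
    Primrec (fun a => f a * g a) := Primrec.nat_mul.comp hf hg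
@[fun_prop] theorem pr_div {f g : α → ℕ} (hf : Primrec f) (hg : Primrec g) :
    Primrec (fun a => f a / g a) := Primrec.nat_div.comp hf hg
@[fun_prop] theorem pr_mod {f g : α → ℕ} (hf : Primrec f) (hg : Primrec g) :
    Primrec (fun a => f a % g a) := Primrec.nat_mod.comp hf hg
@[fun_prop] theorem pr_natpair {f g : α → ℕ} (hf : Primrec f) (hg : Primrec g) :
    Primrec (fun a => Nat.pair (f a) (g a)) := Primrec₂.natPair.comp hf hg
@[fun_prop] theorem pr_unpair {f : α → ℕ} (hf : Primrec f) :
    Primrec (fun a => Nat.unpair (f a)) := Primrec.unpair.comp hf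
@[fun_prop] theorem pr_encode {f : α → List ℕ} (hf : Primrec f) :
    Primrec (fun a => encode (f a)) := Primrec.encode.comp hf
@[fun_prop] theorem pr_cons {f : α → β} {g : α → List β} (hf : Primrec f) (hg : Primrec g) :
    Primrec (fun a => f a :: g a) := Primrec.list_cons.comp hf hg
@[fun_prop] theorem pr_append {f g : α → List β} (hf : Primrec f) (hg : Primrec g) :
    Primrec (fun a => f a ++ g a) := Primrec.list_append.comp hf hg
@[fun_prop] theorem pr_take {f : α → ℕ} {g : α → List β} (hf : Primrec f) (hg : Primrec g) :
    Primrec (fun a => (g a).take (f a)) := Primrec.list_take.comp hf hg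
@[fun_prop] theorem pr_drop {f : α → ℕ} {g : α → List β} (hf : Primrec f) (hg : Primrec g) :
    Primrec (fun a => (g a).drop (f a)) := Primrec.list_drop.comp hf hg
@[fun_prop] theorem pr_tail {g : α → List β} (hg : Primrec g) :
    Primrec (fun a => (g a).tail) := Primrec.list_tail.comp hg
@[fun_prop] theorem pr_headI {g : α → List ℕ} (hg : Primrec g) :
    Primrec (fun a => (g a).headI) := Primrec.list_headI.comp hg
@[fun_prop] theorem pr_range {f : α → ℕ} (hf : Primrec f) :
    Primrec (fun a => List.range (f a)) := Primrec.list_range.comp hf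
theorem pr_map {f : α → List β} {g : α → β → σ} (hf : Primrec f)
    (hg : Primrec (fun p : α × β => g p.1 p.2)) : Primrec (fun a => (f a).map (g a)) :=
  Primrec.list_map hf hg
theorem pr_flatMap {f : α → List β} {g : α → β → List σ} (hf : Primrec f)
    (hg : Primrec (fun p : α × β => g p.1 p.2)) : Primrec (fun a => (f a).flatMap (g a)) :=
  Primrec.list_flatMap hf hg
theorem pr_foldr {f : α → List β} {g : α → σ} {h : α → β → σ → σ} (hf : Primrec f)
    (hg : Primrec g) (hh : Primrec (fun p : α × β × σ => h p.1 p.2.1 p.2.2)) :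
    Primrec (fun a => (f a).foldr (h a) (g a)) :=
  Primrec.list_foldr (h := fun a p => h a p.1 p.2) hf hg hh
theorem pr_iteEq {x y : α → ℕ} {f g : α → σ} (hx : Primrec x) (hy : Primrec y)
    (hf : Primrec f) (hg : Primrec g) : Primrec (fun a => if x a = y a then f a else g a) :=
  Primrec.ite (Primrec.eq.comp hx hy) hf hg
theorem pr_pow2 : Primrec (fun n : ℕ => 2 ^ n) :=
  (Primrec.nat_rec₁ 1 (f := fun _ x => x * 2) (by unfold Primrec₂; fun_prop)).of_eq (by
    intro n; induction n with
    | zero => rfl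
    | succ n ih => rw [pow_succ, ← ih])
@[fun_prop] theorem pr_pow {f : α → ℕ} (hf : Primrec f) : Primrec (fun a => 2 ^ (f a)) :=
  pr_pow2.comp hf
attribute [fun_prop] pr_iteEq pr_map pr_flatMap pr_foldr
end prim

/-- Decode a number as a list of numbers. -/
def dl (c : ℕ) : List ℕ := (decode (α := List ℕ) c).getD []

@[simp] theorem dl_encode (l : List ℕ) : dl (encode l) = l := by simp [dl]

@[fun_prop] theorem pr_dl : Primrec dl :=
  Primrec.option_getD.comp Primrec.decode (Primrec.const [])

/-- Processing one token of a term (from right to left). The state consists of the stack of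
names of completed subterms and the list of all names produced so far. -/
def tStep (tok : ℕ) (st : List ℕ × List ℕ) : List ℕ × List ℕ :=
  (encode (tok :: st.1.take (if tok % 2 = 0 then 0 else (tok / 2).unpair.1)) ::
    st.1.drop (if tok % 2 = 0 then 0 else (tok / 2).unpair.1),
   encode (tok :: st.1.take (if tok % 2 = 0 then 0 else (tok / 2).unpair.1)) :: st.2)

def tRun (l : List ℕ) : List ℕ × List ℕ := l.foldr tStep ([], [])

/-- Processing one token of a formula (from right to left). -/
def fStep (tok : ℕ) (st : List ℕ × List ℕ) : List ℕ × List ℕ :=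
  if tok % 2 = 0 then
    (2 * (tRun (dl (tok / 2).unpair.2)).1.headI :: st.1,
      (tRun (dl (tok / 2).unpair.2)).2 ++ st.2)
  else if tok % 4 = 1 then
    (2 * encode (0 :: tok :: ((st.1.drop 1).take (tok / 4).unpair.1).map (fun x => x / 2)) ::
      0 :: st.1.drop ((tok / 4).unpair.1 + 1),
     encode (0 :: tok :: ((st.1.drop 1).take (tok / 4).unpair.1).map (fun x => x / 2)) :: st.2)
  else (tok :: st.1, st.2)

def fRun (c : ℕ) : List ℕ × List ℕ := (dl c).foldr fStep ([], [])

/-- Token of the `j`-th variable at level `m`. -/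
def vTok (m j : ℕ) : ℕ := 2 * Nat.pair m (encode [2 * (2 * (j % m) + 1)])

/-- Token of a function symbol applied to variables at level `m`. -/
def appTok (m k f : ℕ) (args : List ℕ) : ℕ :=
  2 * Nat.pair m (encode ((2 * Nat.pair k f + 1) :: args.map (fun j => 2 * (2 * (j % m) + 1))))

/-- Whether a symbol code belongs to the side with residue `r`. -/
def symOk (r s : ℕ) : ℕ := if s % 2 = 0 then 1 else if s % 4 = r then 1 else 0

/-- Translation of symbol codes. -/
def symVal (s : ℕ) : ℕ := if s % 2 = 0 then s else 2 * (s / 4) + 1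

def relToks (m k s : ℕ) (args : List ℕ) : List ℕ :=
  (4 * Nat.pair k s + 1) :: (4 * m + 3) :: args.map (fun j => vTok m j)

/-- Tokens of the definitional hypotheses attached to the name `N`. -/
def defToks (r m N : ℕ) : List ℕ :=
  if (dl N).headI = 0 then
    if symOk r ((dl N).tail.headI / 4).unpair.2 = 1 then
      (3 :: 3 :: (relToks m ((dl N).tail.headI / 4).unpair.1
        (symVal ((dl N).tail.headI / 4).unpair.2) (dl N).tail.tail ++ [vTok m N, vTok m 0])) ++
      (3 :: 3 :: vTok m N :: vTok m 0 :: relToks m ((dl N).tail.headI / 4).unpair.1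
        (symVal ((dl N).tail.headI / 4).unpair.2) (dl N).tail.tail)
    else []
  else if (dl N).headI % 2 = 1 then
    if symOk r ((dl N).headI / 2).unpair.2 = 1 then
      [3, appTok m ((dl N).headI / 2).unpair.1 (symVal ((dl N).headI / 2).unpair.2) (dl N).tail,
        vTok m N]
    else []
  else []

/-- Tokens of the arrangement with bits `w`, at position `q`. -/
def arrTok (m w q : ℕ) : List ℕ :=
  if w / 2 ^ q % 2 = 1 then 3 :: relToks m 2 0 [q / m, q % m]
  else 3 :: 3 :: (relToks m 2 0 [q / m, q % m] ++ [4 * m + 11])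

/-- Final translation of matrix tokens. -/
def finTok (m tok : ℕ) : ℕ :=
  if tok % 2 = 0 then vTok m (tok / 2) else if tok = 3 then 3 else 4 * m + 11

/-- The code of the sentence to be tested. -/
def sigCode (r m w : ℕ) (out names : List ℕ) : ℕ :=
  encode ((List.range m).map (fun _ => 7) ++ ((List.range (m * m)).flatMap (fun q => arrTok m w q)
    ++ (names.flatMap (fun N => defToks r m N) ++ out.map (fun t => finTok m t))))

def mOf (names : List ℕ) : ℕ := names.foldr (fun a b => a + b) 0 + 1

def outOf (c : ℕ) : List ℕ := (fRun c).1.dropWhile (fun x => decide (x = 7))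

def cntOf (l : List ℕ) : ℕ := l.foldr (fun a b => if a = 7 then b + 1 else b) 0

/-- The combined decision procedure. -/
def combine (f₁ f₂ : ℕ → Bool) (c : ℕ) : Bool :=
  bif decide (cntOf (outOf c) = 0) then
    Nat.rec true (fun w acc => acc &&
      (f₁ (sigCode 1 (mOf (fRun c).2) w (outOf c) (fRun c).2) ||
        f₂ (sigCode 3 (mOf (fRun c).2) w (outOf c) (fRun c).2)))
      (2 ^ (mOf (fRun c).2 * mOf (fRun c).2))
  else false

@[fun_prop] theorem pr_tRun : Primrec tRun := by unfold tRun tStep; fun_prop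
@[fun_prop] theorem pr_fRun : Primrec fRun := by unfold fRun fStep; fun_prop
@[fun_prop] theorem pr_outOf : Primrec outOf :=
  (Primrec.list_dropWhile (Primrec.eq.comp Primrec.id (Primrec.const 7)).decide).comp
    (Primrec.fst.comp pr_fRun)
@[fun_prop] theorem pr_cntOf : Primrec cntOf := by unfold cntOf; fun_prop
@[fun_prop] theorem pr_mOf : Primrec mOf := by unfold mOf; fun_prop
theorem pr_sigCode (r : ℕ) :
    Primrec (fun p : ℕ × ℕ × List ℕ × List ℕ => sigCode r p.1 p.2.1 p.2.2.1 p.2.2.2) := by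
  unfold sigCode defToks arrTok finTok relToks appTok vTok symOk symVal
  fun_prop

theorem combine_computable {f₁ f₂ : ℕ → Bool} (h₁ : Computable f₁) (h₂ : Computable f₂) :
    Computable (combine f₁ f₂) := by
  unfold combine
  have hs (r : ℕ) : Primrec (fun p : ℕ × ℕ × Bool =>
      sigCode r (mOf (fRun p.1).2) p.2.1 (outOf p.1) (fRun p.1).2) :=
    (pr_sigCode r).comp (f := fun p : ℕ × _ × _ × _ => _)
      (g := fun p : ℕ × ℕ × Bool => (mOf (fRun p.1).2, p.2.1, outOf p.1, (fRun p.1).2))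
      (by fun_prop)
  refine Computable.cond ?_ ?_ (Computable.const false)
  · exact (Primrec.eq.comp (pr_cntOf.comp pr_outOf) (Primrec.const 0)).decide.to_comp
  · refine Computable.nat_rec (h := fun c (p : ℕ × Bool) => p.2 &&
      (f₁ (sigCode 1 (mOf (fRun c).2) p.1 (outOf c) (fRun c).2) ||
        f₂ (sigCode 3 (mOf (fRun c).2) p.1 (outOf c) (fRun c).2))) ?_ (Computable.const true) ?_
    · have : Primrec (fun c => 2 ^ (mOf (fRun c).2 * mOf (fRun c).2)) := by fun_prop
      exact this.to_comp
    · exact (Primrec.and.to_comp).comp (Computable.snd.comp Computable.snd)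
        ((Primrec.or.to_comp).comp (h₁.comp (hs 1).to_comp) (h₂.comp (hs 3).to_comp))

theorem combine_iff (f₁ f₂ : ℕ → Bool) (c : ℕ) : combine f₁ f₂ c = true ↔
    7 ∉ outOf c ∧ ∀ w < 2 ^ (mOf (fRun c).2 * mOf (fRun c).2),
      f₁ (sigCode 1 (mOf (fRun c).2) w (outOf c) (fRun c).2) = true ∨
        f₂ (sigCode 3 (mOf (fRun c).2) w (outOf c) (fRun c).2) = true := by
  have h1 : ∀ l : List ℕ, cntOf l = 0 ↔ 7 ∉ l := by
    intro l
    induction l with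
    | nil => simp [cntOf]
    | cons a l ih =>
      have : cntOf (a :: l) = if a = 7 then cntOf l + 1 else cntOf l := rfl
      rw [this]
      split_ifs with h
      · simp [h]
      · simp [ih, Ne.symm h]
  have h2 : ∀ (g : ℕ → Bool) (n : ℕ),
      (Nat.rec true (fun w acc => acc && g w) n : Bool) = true ↔ ∀ w < n, g w = true := by
    intro g n
    induction n with
    | zero => simp
    | succ n ih =>
      simp only [Bool.and_eq_true, ih, Nat.lt_succ_iff_lt_or_eq]
      constructor
      · rintro ⟨a, b⟩ w (hw | rfl)
        exacts [a w hw, b]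
      · exact fun h => ⟨fun w hw => h w (Or.inl hw), h n (Or.inr rfl)⟩
  unfold combine
  by_cases h : cntOf (outOf c) = 0
  · have h' := (h1 _).1 h
    rw [decide_eq_true h, cond_true]
    refine (h2 (fun w => f₁ (sigCode 1 (mOf (fRun c).2) w (outOf c) (fRun c).2) ||
        f₂ (sigCode 3 (mOf (fRun c).2) w (outOf c) (fRun c).2)) _).trans ?_
    simp only [Bool.or_eq_true, h', not_false_eq_true, true_and]
  · have h' := mt (h1 _).2 h
    simp [h]
    intro h3
    exact absurd h3 h'

end

section

open FirstOrder Language Encodable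

theorem encode_list_map {α : Type} [Encodable α] (l : List α) :
    encode l = encode (l.map encode) := by
  induction l with
  | nil => rfl
  | cons a l ih => simp [encode_list_cons, ih]

section syn
variable {L : FirstOrder.Language.{0, 0}} [∀ n, Encodable (L.Functions n)] [∀ n, Encodable (L.Relations n)]

theorem encode_term {α : Type} [Encodable α] (t : L.Term α) :
    encode t = encode (t.listEncode.map encode) := by
  rw [← encode_list_map]; rfl

/-- The list of token codes of a formula. -/
def toks {n : ℕ} (φ : L.BoundedFormula Empty n) : List ℕ := φ.listEncode.map encode

theorem encode_sentence (φ : L.Sentence) : encode φ = encode (toks φ) := by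
  unfold toks
  rw [← encode_list_map]; rfl

/-- Name of a term. -/
def nmT {n : ℕ} : L.Term (Empty ⊕ Fin n) → ℕ
  | .var x => encode [encode (Sum.inl x : (Empty ⊕ Fin n) ⊕ (Σ i, L.Functions i))]
  | .func (l := l) f ts =>
    encode (encode (Sum.inr ⟨_, f⟩ : (Empty ⊕ Fin n) ⊕ (Σ i, L.Functions i)) ::
      (List.finRange l).map (fun i => nmT (ts i)))

/-- Name of an atom. -/
def nmA {n k : ℕ} (R : L.Relations k) (ts : Fin k → L.Term (Empty ⊕ Fin n)) : ℕ :=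
  encode (0 :: (4 * Nat.pair k (encode R) + 1) :: (List.finRange k).map (fun i => nmT (ts i)))

/-- Subterms. -/
def subT {n : ℕ} : L.Term (Empty ⊕ Fin n) → List (L.Term (Empty ⊕ Fin n))
  | .var x => [.var x]
  | .func (l := l) f ts => .func f ts :: (List.finRange l).flatMap (fun i => subT (ts i))

theorem tRun_aux {n : ℕ} (t : L.Term (Empty ⊕ Fin n)) (st : List ℕ × List ℕ) :
    (t.listEncode.map encode).foldr tStep st = (nmT t :: st.1, (subT t).map nmT ++ st.2) := by
  induction t generalizing st with
  | var x =>
    simp [Term.listEncode, tStep, nmT, subT]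
  | @func l f ts ih =>
    have key : ∀ is : List (Fin l),
        ((is.flatMap fun i => (ts i).listEncode).map encode).foldr tStep st =
          (is.map (fun i => nmT (ts i)) ++ st.1,
            (is.flatMap (fun i => subT (ts i))).map nmT ++ st.2) := by
      intro is
      induction is with
      | nil => simp
      | cons i is ihs =>
        rw [List.flatMap_cons, List.map_append, List.foldr_append, ihs, ih]
        simp
    rw [Term.listEncode, List.map_cons, List.foldr_cons, key]
    have h1 : (2 * Nat.pair l (encode f) + 1) % 2 = 1 := by omega
    have h2 : (2 * Nat.pair l (encode f) + 1) / 2 = Nat.pair l (encode f) := by omega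
    simp [tStep, nmT, subT, h1, h2]

theorem tRun_term {n : ℕ} (t : L.Term (Empty ⊕ Fin n)) :
    tRun (t.listEncode.map encode) = ([nmT t], (subT t).map nmT) := by
  simp [tRun, tRun_aux]

/-- Output stream. -/
def stream : ∀ {n : ℕ}, L.BoundedFormula Empty n → List ℕ
  | n, .falsum => [4 * n + 11]
  | _, .equal t₁ t₂ => [2 * nmT t₁, 2 * nmT t₂]
  | _, .rel R ts => [2 * nmA R ts, 0]
  | _, .imp φ ψ => 3 :: (stream φ ++ stream ψ)
  | _, .all φ => 7 :: stream φ

/-- Names occurring in a formula. -/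
def namesF : ∀ {n : ℕ}, L.BoundedFormula Empty n → List ℕ
  | _, .falsum => []
  | _, .equal t₁ t₂ => (subT t₁).map nmT ++ (subT t₂).map nmT
  | _, .rel (l := l) R ts =>
    nmA R ts :: (List.finRange l).flatMap (fun i => (subT (ts i)).map nmT)
  | _, .imp φ ψ => namesF φ ++ namesF ψ
  | _, .all φ => namesF φ

theorem fStep_term {n : ℕ} (t : L.Term (Empty ⊕ Fin n)) (st : List ℕ × List ℕ) :
    fStep (encode (Sum.inl ⟨n, t⟩ : (Σ k, L.Term (Empty ⊕ Fin k)) ⊕ ((Σ n, L.Relations n) ⊕ ℕ))) st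
      = (2 * nmT t :: st.1, (subT t).map nmT ++ st.2) := by
  simp [fStep, encode_term, tRun_term]

theorem fRun_aux {n : ℕ} (φ : L.BoundedFormula Empty n) (st : List ℕ × List ℕ) :
    (toks φ).foldr fStep st = (stream φ ++ st.1, namesF φ ++ st.2) := by
  induction φ generalizing st with
  | falsum =>
    rename_i n
    have h : 2 * (2 * (n + 2) + 1) + 1 = 4 * n + 11 := by ring
    have h1 : (4 * n + 11) % 2 = 1 := by omega
    have h2 : (4 * n + 11) % 4 = 3 := by omega
    simp [toks, BoundedFormula.listEncode, h, fStep, h1, h2, stream, namesF]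
  | equal t₁ t₂ =>
    simp only [toks, BoundedFormula.listEncode, List.map_cons, List.foldr_cons, List.map_nil,
      List.foldr_nil, fStep_term, stream, namesF]
    simp
  | @rel n l R ts =>
    have key : ∀ is : List (Fin l),
        ((is.map fun i => (Sum.inl ⟨n, ts i⟩ :
          (Σ k, L.Term (Empty ⊕ Fin k)) ⊕ ((Σ n, L.Relations n) ⊕ ℕ))).map encode).foldr fStep st =
          (is.map (fun i => 2 * nmT (ts i)) ++ st.1,
            (is.flatMap (fun i => (subT (ts i)).map nmT)) ++ st.2) := by
      intro is
      induction is with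
      | nil => simp
      | cons i is ihs =>
        rw [List.map_cons, List.map_cons, List.foldr_cons, ihs, fStep_term]
        simp
    have h : 2 * (2 * n + 1) + 1 = 4 * n + 3 := by ring
    have h1 : (4 * n + 3) % 2 = 1 := by omega
    have h2 : (4 * n + 3) % 4 = 3 := by omega
    have h' : 2 * (2 * Nat.pair l (encode R)) + 1 = 4 * Nat.pair l (encode R) + 1 := by ring
    have h1' : (4 * Nat.pair l (encode R) + 1) % 2 = 1 := by omega
    have h2' : (4 * Nat.pair l (encode R) + 1) % 4 = 1 := by omega
    have h3' : (4 * Nat.pair l (encode R) + 1) / 4 = Nat.pair l (encode R) := by omega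
    simp only [toks, BoundedFormula.listEncode, List.map_append, List.map_cons, List.map_nil,
      List.foldr_append, key, List.foldr_cons, List.foldr_nil, encode_inr, encode_inl,
      encode_sigma_val, encode_nat, h, h']
    simp [fStep, h1, h2, h1', h2', h3', stream, namesF, nmA, List.take_append, List.drop_append,
      Function.comp_def]
  | imp φ ψ ih₁ ih₂ =>
    have : toks (φ.imp ψ) = 3 :: (toks φ ++ toks ψ) := by
      simp [toks, BoundedFormula.listEncode]
    rw [this, List.foldr_cons, List.foldr_append, ih₂, ih₁]
    simp [fStep, stream, namesF]
  | all φ ih =>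
    have : toks (φ.all) = 7 :: (toks φ) := by
      simp [toks, BoundedFormula.listEncode]
    rw [this, List.foldr_cons, ih]
    simp [fStep, stream, namesF]

theorem fRun_sentence (φ : L.Sentence) : fRun (encode φ) = (stream φ, namesF φ) := by
  rw [encode_sentence, fRun, dl_encode, fRun_aux]; simp

theorem isQF_iff {n : ℕ} (φ : L.BoundedFormula Empty n) : φ.IsQF ↔ 7 ∉ stream φ := by
  constructor
  · intro h
    induction h with
    | falsum => simp [stream]
    | of_isAtomic h =>
      cases h with
      | equal t₁ t₂ => simp [Term.bdEqual, stream]; omega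
      | rel R ts => simp [Relations.boundedFormula, stream]; omega
    | imp _ _ ih₁ ih₂ => simp [stream, ih₁, ih₂]
  · intro h
    induction φ with
    | falsum => exact .falsum
    | equal t₁ t₂ => exact .of_isAtomic (.equal t₁ t₂)
    | rel R ts => exact .of_isAtomic (.rel R ts)
    | imp φ ψ ih₁ ih₂ =>
      simp [stream] at h
      exact .imp (ih₁ h.1) (ih₂ h.2)
    | all φ ih => simp [stream] at h

theorem dropWhile_of_notMem (l : List ℕ) (h : 7 ∉ l) :
    l.dropWhile (fun x => decide (x = 7)) = l := by
  cases l with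
  | nil => rfl
  | cons a l =>
    have : ¬ a = 7 := fun h' => h (by simp [h'])
    simp [this]

theorem stream_alls {n : ℕ} (ψ : L.BoundedFormula Empty n) :
    (stream ψ.alls).dropWhile (fun x => decide (x = 7)) =
      (stream ψ).dropWhile (fun x => decide (x = 7)) := by
  induction n with
  | zero => rfl
  | succ n ih =>
    rw [BoundedFormula.alls, ih, stream]
    simp

theorem names_alls {n : ℕ} (ψ : L.BoundedFormula Empty n) : namesF ψ.alls = namesF ψ := by
  induction n with
  | zero => rfl
  | succ n ih => rw [BoundedFormula.alls, ih, namesF]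

theorem exists_alls {n : ℕ} (χ : L.BoundedFormula Empty n)
    (h : 7 ∉ (stream χ).dropWhile (fun x => decide (x = 7))) :
    ∃ (k : ℕ) (ψ : L.BoundedFormula Empty k), ψ.IsQF ∧ χ.alls = ψ.alls := by
  induction χ with
  | all φ ih =>
    rw [stream] at h
    simp only [List.dropWhile_cons, decide_true, if_true] at h
    exact ih h
  | falsum => exact ⟨_, _, (isQF_iff _).2 (by rw [stream] at h ⊢; simp), rfl⟩
  | equal => exact ⟨_, _, (isQF_iff _).2 (by rw [stream] at h ⊢; simp; omega), rfl⟩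
  | rel => exact ⟨_, _, (isQF_iff _).2 (by rw [stream] at h ⊢; simp; omega), rfl⟩
  | imp => exact ⟨_, _, (isQF_iff _).2 (by rw [stream] at h ⊢; simpa using h), rfl⟩

theorem isUniversal_iff (φ : L.Sentence) : IsUniversalSentence φ ↔ 7 ∉ outOf (encode φ) := by
  rw [outOf, fRun_sentence]
  constructor
  · rintro ⟨n, ψ, hψ, rfl⟩
    rw [isQF_iff] at hψ
    simpa only [stream_alls, dropWhile_of_notMem _ hψ] using hψ
  · exact exists_alls φ

theorem outOf_alls {n : ℕ} (ψ : L.BoundedFormula Empty n) (h : ψ.IsQF) :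
    outOf (encode (α := L.Sentence) ψ.alls) = stream ψ := by
  rw [outOf, fRun_sentence]
  simpa only [stream_alls] using dropWhile_of_notMem _ ((isQF_iff _).1 h)

/-- Items: subterms and atoms. -/
inductive Item (L : FirstOrder.Language.{0, 0}) (n : ℕ) : Type
  | tm (t : L.Term (Empty ⊕ Fin n)) : Item L n
  | atm {k : ℕ} (R : L.Relations k) (ts : Fin k → L.Term (Empty ⊕ Fin n)) : Item L n

def nmI {n : ℕ} : Item L n → ℕ
  | .tm t => nmT t
  | .atm R ts => nmA R ts

def items : ∀ {n : ℕ}, L.BoundedFormula Empty n → List (Item L n)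
  | _, .falsum => []
  | _, .equal t₁ t₂ => (subT t₁).map .tm ++ (subT t₂).map .tm
  | _, .rel (l := l) R ts =>
    .atm R ts :: (List.finRange l).flatMap (fun i => (subT (ts i)).map .tm)
  | _, .imp φ ψ => items φ ++ items ψ
  | _, .all _ => []

theorem names_items {n : ℕ} (ψ : L.BoundedFormula Empty n) (h : ψ.IsQF) :
    namesF ψ = (items ψ).map nmI := by
  induction h with
  | falsum => rfl
  | of_isAtomic h =>
    cases h with
    | equal t₁ t₂ =>
      simp [Term.bdEqual, namesF, items, Function.comp_def, nmI]
    | rel R ts =>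
      simp [Relations.boundedFormula, namesF, items, Function.comp_def, nmI, List.map_flatMap]
  | imp _ _ ih₁ ih₂ => simp [namesF, items, ih₁, ih₂]

end syn

end

section

open FirstOrder Language Encodable

set_option linter.unusedSectionVars false

section sig
variable {L K : FirstOrder.Language.{0, 0}} [∀ n, Encodable (L.Functions n)]
  [∀ n, Encodable (L.Relations n)] [∀ n, Encodable (K.Functions n)]
  [∀ n, Encodable (K.Relations n)]

/-- One side of the combination: a partial map of symbols from `L` to `K`. -/
structure Side (L K : FirstOrder.Language.{0, 0}) [∀ n, Encodable (L.Functions n)]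
    [∀ n, Encodable (L.Relations n)] [∀ n, Encodable (K.Functions n)]
    [∀ n, Encodable (K.Relations n)] (r : ℕ) where
  fs : ∀ k, L.Functions k → Option (K.Functions k)
  rs : ∀ k, L.Relations k → Option (K.Relations k)
  lt : K.Relations 2
  fs_none : ∀ k f, fs k f = none → symOk r (encode f) ≠ 1
  fs_some : ∀ k f f', fs k f = some f' → symOk r (encode f) = 1 ∧ encode f' = symVal (encode f)
  rs_none : ∀ k f, rs k f = none → symOk r (encode f) ≠ 1
  rs_some : ∀ k f f', rs k f = some f' → symOk r (encode f) = 1 ∧ encode f' = symVal (encode f)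
  lt_code : encode lt = 0

/-- Variable number `j` modulo `m`. -/
def vr (K : FirstOrder.Language.{0, 0}) (m : ℕ) [NeZero m] (j : ℕ) : K.Term (Empty ⊕ Fin m) :=
  .var (.inr (Fin.ofNat m j))

/-- Token of a term. -/
def tmTok {m : ℕ} (t : K.Term (Empty ⊕ Fin m)) : ℕ :=
  encode (Sum.inl ⟨m, t⟩ : (Σ k, K.Term (Empty ⊕ Fin k)) ⊕ ((Σ n, K.Relations n) ⊕ ℕ))

theorem encFin (m : ℕ) [NeZero m] (j : ℕ) : encode (Fin.ofNat m j) = j % m := rfl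

theorem tmTok_vr (m : ℕ) [NeZero m] (j : ℕ) : tmTok (vr K m j) = vTok m j := by
  simp [tmTok, vr, encode_term, Term.listEncode, vTok, encFin, -Fin.ofNat_eq_cast]

theorem tmTok_app (m : ℕ) [NeZero m] {k : ℕ} (f : K.Functions k) (a : Fin k → ℕ) :
    tmTok (.func f (fun i => vr K m (a i))) =
      appTok m k (encode f) ((List.finRange k).map a) := by
  have h : ∀ l : List (Fin k),
      (l.flatMap fun i => (vr K m (a i)).listEncode).map encode =
        l.map (fun i => 2 * (2 * (a i % m) + 1)) := by
    intro l
    induction l with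
    | nil => rfl
    | cons i l ih =>
      rw [List.flatMap_cons, List.map_append, ih]
      simp [vr, Term.listEncode, encFin, -Fin.ofNat_eq_cast]
  rw [tmTok, encode_inl, encode_sigma_val, encode_term, Term.listEncode, List.map_cons, h]
  simp [appTok, Function.comp_def]

theorem toks_imp {n : ℕ} (φ ψ : K.BoundedFormula Empty n) :
    toks (φ.imp ψ) = 3 :: (toks φ ++ toks ψ) := by
  simp [toks, BoundedFormula.listEncode]

theorem toks_falsum {n : ℕ} : toks (.falsum : K.BoundedFormula Empty n) = [4 * n + 11] := by
  simp [toks, BoundedFormula.listEncode]; ring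

theorem toks_equal {n : ℕ} (s t : K.Term (Empty ⊕ Fin n)) :
    toks (.equal s t) = [tmTok s, tmTok t] := by
  simp [toks, tmTok, BoundedFormula.listEncode]

theorem toks_rel (m : ℕ) [NeZero m] {k : ℕ} (R : K.Relations k) (a : Fin k → ℕ) :
    toks (.rel R (fun i => vr K m (a i))) =
      relToks m k (encode R) ((List.finRange k).map a) := by
  have : ∀ j, encode (vr K m j) = encode [2 * (2 * (j % m) + 1)] := by
    intro j
    simp [vr, encode_term, Term.listEncode, encFin, -Fin.ofNat_eq_cast]
  simp [toks, BoundedFormula.listEncode, relToks, Function.comp_def, this, vTok]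
  constructor <;> ring

theorem toks_alls {n : ℕ} (ψ : K.BoundedFormula Empty n) :
    toks ψ.alls = (List.range n).map (fun _ => 7) ++ toks ψ := by
  induction n with
  | zero => simp [BoundedFormula.alls]
  | succ n ih =>
    have : toks (ψ.all) = 7 :: (toks ψ) := by
      simp [toks, BoundedFormula.listEncode]
    rw [BoundedFormula.alls, ih, this, List.range_succ]
    simp

/-- Iterated implication. -/
def impL {n : ℕ} (l : List (K.BoundedFormula Empty n)) (ψ : K.BoundedFormula Empty n) :
    K.BoundedFormula Empty n := l.foldr (fun a b => a.imp b) ψ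

theorem toks_impL {n : ℕ} (l : List (K.BoundedFormula Empty n)) (ψ : K.BoundedFormula Empty n) :
    toks (impL l ψ) = l.flatMap (fun φ => 3 :: toks φ) ++ toks ψ := by
  induction l with
  | nil => rfl
  | cons a l ih =>
    have : impL (a :: l) ψ = a.imp (impL l ψ) := rfl
    rw [this, toks_imp, ih]; simp

theorem realize_impL {n : ℕ} (l : List (K.BoundedFormula Empty n)) (ψ : K.BoundedFormula Empty n)
    {M : Type*} [K.Structure M] (e : Empty → M) (v : Fin n → M) :
    (impL l ψ).Realize e v ↔ ((∀ φ ∈ l, φ.Realize e v) → ψ.Realize e v) := by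
  induction l with
  | nil => simp [impL]
  | cons a l ih =>
    have : impL (a :: l) ψ = a.imp (impL l ψ) := rfl
    rw [this, BoundedFormula.realize_imp, ih]; simp

theorem qf_impL {n : ℕ} (l : List (K.BoundedFormula Empty n)) (ψ : K.BoundedFormula Empty n)
    (h : ∀ φ ∈ l, φ.IsQF) (h' : ψ.IsQF) : (impL l ψ).IsQF := by
  induction l with
  | nil => exact h'
  | cons a l ih =>
    exact BoundedFormula.IsQF.imp (h a (by simp)) (ih (fun φ hφ => h φ (by simp [hφ])))

/-- Flattened matrix. -/
def star (K : FirstOrder.Language.{0, 0}) (m : ℕ) [NeZero m] :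
    ∀ {n : ℕ}, L.BoundedFormula Empty n → K.BoundedFormula Empty m
  | _, .falsum => .falsum
  | _, .equal t₁ t₂ => .equal (vr K m (nmT t₁)) (vr K m (nmT t₂))
  | _, .rel R ts => .equal (vr K m (nmA R ts)) (vr K m 0)
  | _, .imp φ ψ => .imp (star K m φ) (star K m ψ)
  | _, .all _ => .falsum

theorem qf_star (m : ℕ) [NeZero m] {n : ℕ} (ψ : L.BoundedFormula Empty n) :
    (star K m ψ).IsQF := by
  induction ψ with
  | falsum => exact .falsum
  | equal => exact .of_isAtomic (.equal _ _)
  | rel => exact .of_isAtomic (.equal _ _)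
  | imp _ _ h1 h2 => exact .imp h1 h2
  | all => exact .falsum

theorem toks_star (m : ℕ) [NeZero m] {n : ℕ} (ψ : L.BoundedFormula Empty n) (h : ψ.IsQF) :
    toks (star K m ψ) = (stream ψ).map (finTok m) := by
  induction h with
  | falsum =>
    rename_i n
    have h1 : (4 * n + 11) % 2 = 1 := by omega
    simp [star, stream, toks_falsum, finTok, h1]
  | of_isAtomic h =>
    cases h with
    | equal t₁ t₂ =>
      simp [Term.bdEqual, star, stream, toks_equal, tmTok_vr, finTok]
    | rel R ts =>
      simp [Relations.boundedFormula, star, stream, toks_equal, tmTok_vr, finTok]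
  | imp _ _ ih₁ ih₂ => simp [star, stream, ih₁, ih₂, toks_imp, finTok]

variable {r : ℕ} (S : Side L K r)

/-- Definitional hypotheses of an item. -/
def defF (m : ℕ) [NeZero m] {n : ℕ} : Item L n → List (K.BoundedFormula Empty m)
  | .tm (.var _) => []
  | .tm (.func (l := k) f ts) =>
    match S.fs k f with
    | none => []
    | some f' => [.equal (.func f' (fun i => vr K m (nmT (ts i)))) (vr K m (nmT (.func f ts)))]
  | .atm (k := k) R ts =>
    match S.rs k R with
    | none => []
    | some R' =>
      [.imp (.rel R' (fun i => vr K m (nmT (ts i)))) (.equal (vr K m (nmA R ts)) (vr K m 0)),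
       .imp (.equal (vr K m (nmA R ts)) (vr K m 0)) (.rel R' (fun i => vr K m (nmT (ts i))))]

theorem dl_var {n : ℕ} (x : Fin n) :
    dl (nmT (.var (.inr x) : L.Term (Empty ⊕ Fin n))) = [2 * (2 * (x : ℕ) + 1)] := by
  rw [nmT, dl_encode]
  rfl

theorem dl_func {n k : ℕ} (f : L.Functions k) (ts : Fin k → L.Term (Empty ⊕ Fin n)) :
    dl (nmT (.func f ts)) = (2 * Nat.pair k (encode f) + 1) ::
      (List.finRange k).map (fun i => nmT (ts i)) := by
  rw [nmT, dl_encode]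
  simp

theorem dl_atom {n k : ℕ} (R : L.Relations k) (ts : Fin k → L.Term (Empty ⊕ Fin n)) :
    dl (nmA R ts) = 0 :: (4 * Nat.pair k (encode R) + 1) ::
      (List.finRange k).map (fun i => nmT (ts i)) := by
  rw [nmA, dl_encode]

theorem toks_defF (m : ℕ) [NeZero m] {n : ℕ} (it : Item L n) :
    (defF S m it).flatMap (fun φ => 3 :: toks φ) = defToks r m (nmI it) := by
  match it with
  | .tm (.var x) =>
    rcases x with x | x
    · exact x.elim
    simp [defF, nmI, dl_var, defToks]
  | .tm (.func (l := k) f ts) =>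
    have h1 : (2 * Nat.pair k (encode f) + 1) % 2 = 1 := by omega
    have h2 : (2 * Nat.pair k (encode f) + 1) / 2 = Nat.pair k (encode f) := by omega
    cases hf : S.fs k f with
    | none =>
      have := S.fs_none _ _ hf
      rw [defF]
      simp [hf, nmI, dl_func, defToks, h1, h2, this]
    | some f' =>
      obtain ⟨h3, h4⟩ := S.fs_some _ _ _ hf
      rw [defF]
      simp only [hf, List.flatMap_cons, List.flatMap_nil, toks_equal, tmTok_vr, tmTok_app]
      simp [nmI, defToks, h1, h2, h3, h4, dl_func, Function.comp_def]
  | .atm (k := k) R ts =>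
    have h2 : (4 * Nat.pair k (encode R) + 1) / 4 = Nat.pair k (encode R) := by omega
    cases hf : S.rs k R with
    | none =>
      have := S.rs_none _ _ hf
      rw [defF]
      simp [hf, nmI, dl_atom, defToks, h2, this]
    | some f' =>
      obtain ⟨h3, h4⟩ := S.rs_some _ _ _ hf
      rw [defF]
      simp only [hf, List.flatMap_cons, List.flatMap_nil, toks_imp, toks_equal, tmTok_vr, toks_rel]
      simp [nmI, defToks, h2, h3, h4, dl_atom]

theorem qf_defF (m : ℕ) [NeZero m] {n : ℕ} (it : Item L n) : ∀ φ ∈ defF S m it, φ.IsQF := by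
  intro φ hφ
  have e : ∀ s t : K.Term (Empty ⊕ Fin m), (BoundedFormula.equal s t).IsQF :=
    fun s t => .of_isAtomic (.equal _ _)
  have q : ∀ {k} (R : K.Relations k) (ts : Fin k → K.Term (Empty ⊕ Fin m)),
    (BoundedFormula.rel R ts).IsQF := fun s t => .of_isAtomic (.rel _ _)
  match it with
  | .tm (.var x) => simp [defF] at hφ
  | .tm (.func (l := k) f ts) =>
    rw [defF] at hφ
    cases hf : S.fs k f with
    | none => simp [hf] at hφ
    | some f' =>
      simp [hf] at hφ
      subst hφ
      exact e _ _
  | .atm (k := k) R ts =>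
    rw [defF] at hφ
    cases hf : S.rs k R with
    | none => simp [hf] at hφ
    | some f' =>
      simp [hf] at hφ
      rcases hφ with rfl | rfl
      · exact .imp (q _ _) (e _ _)
      · exact .imp (e _ _) (q _ _)

/-- Arrangement literal. -/
def arrF (m : ℕ) [NeZero m] (w q : ℕ) : K.BoundedFormula Empty m :=
  if w / 2 ^ q % 2 = 1 then .rel S.lt (fun i => vr K m (![q / m, q % m] i))
  else .imp (.rel S.lt (fun i => vr K m (![q / m, q % m] i))) .falsum

theorem toks_arrF (m : ℕ) [NeZero m] (w q : ℕ) : 3 :: toks (arrF S m w q) = arrTok m w q := by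
  have : (List.finRange 2).map ![q / m, q % m] = [q / m, q % m] := by
    simp [List.finRange_succ]
  unfold arrF arrTok
  split_ifs <;>
  simp [toks_rel, toks_imp, toks_falsum, this, S.lt_code]

theorem qf_arrF (m : ℕ) [NeZero m] (w q : ℕ) : (arrF S m w q).IsQF := by
  have q : ∀ {k} (R : K.Relations k) (ts : Fin k → K.Term (Empty ⊕ Fin m)),
    (BoundedFormula.rel R ts).IsQF := fun s t => .of_isAtomic (.rel _ _)
  unfold arrF
  split_ifs
  · exact q _ _
  · exact .imp (q _ _) .falsum

/-- The matrix of the test sentence. -/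
def sigM (m : ℕ) [NeZero m] (w : ℕ) {n : ℕ} (ψ : L.BoundedFormula Empty n) :
    K.BoundedFormula Empty m :=
  impL ((List.range (m * m)).map (arrF S m w)) (impL ((items ψ).flatMap (defF S m)) (star K m ψ))

/-- The test sentence. -/
def sig (m : ℕ) [NeZero m] (w : ℕ) {n : ℕ} (ψ : L.BoundedFormula Empty n) : K.Sentence :=
  (sigM S m w ψ).alls

theorem sig_universal (m : ℕ) [NeZero m] (w : ℕ) {n : ℕ} (ψ : L.BoundedFormula Empty n) :
    IsUniversalSentence (sig S m w ψ) := by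
  refine ⟨_, _, ?_, rfl⟩
  refine qf_impL _ _ ?_ (qf_impL _ _ ?_ (qf_star _ _))
  · intro φ hφ
    obtain ⟨q, _, rfl⟩ := List.mem_map.1 hφ
    exact qf_arrF _ _ _ _
  · intro φ hφ
    obtain ⟨q, _, h⟩ := List.mem_flatMap.1 hφ
    exact qf_defF _ _ _ _ h

theorem encode_sig (m : ℕ) [NeZero m] (w : ℕ) {n : ℕ} (ψ : L.BoundedFormula Empty n)
    (h : ψ.IsQF) : encode (sig S m w ψ) = sigCode r m w (stream ψ) (namesF ψ) := by
  rw [encode_sentence, sig, toks_alls, sigM, toks_impL, toks_impL, toks_star _ _ h, sigCode,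
    names_items _ h]
  congr 3
  · rw [List.flatMap_map]
    congr 1
    funext q
    exact toks_arrF S m w q
  · rw [List.flatMap_assoc, List.flatMap_map]
    congr 2
    funext q
    exact toks_defF S m q

end sig

end

section

open FirstOrder Language Encodable

set_option linter.unusedSectionVars false

section sem
variable {L K : FirstOrder.Language.{0, 0}} [∀ n, Encodable (L.Functions n)]
  [∀ n, Encodable (L.Relations n)] [∀ n, Encodable (K.Functions n)]
  [∀ n, Encodable (K.Relations n)]

/-- The flattened matrix evaluated on names. -/
def StarOK {M : Type} (x : ℕ → M) : ∀ {n : ℕ}, L.BoundedFormula Empty n → Prop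
  | _, .falsum => False
  | _, .equal t₁ t₂ => x (nmT t₁) = x (nmT t₂)
  | _, .rel R ts => x (nmA R ts) = x 0
  | _, .imp φ ψ => StarOK x φ → StarOK x ψ
  | _, .all _ => False

theorem realize_vr {M : Type} [K.Structure M] (m : ℕ) [NeZero m] (e : Empty → M) (v : Fin m → M)
    (j : ℕ) : (vr K m j).realize (Sum.elim e v) = v (Fin.ofNat m j) := rfl

theorem realize_star {M : Type} [K.Structure M] (m : ℕ) [NeZero m] (e : Empty → M)
    (v : Fin m → M) {n : ℕ} (ψ : L.BoundedFormula Empty n) :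
    (star K m ψ).Realize e v ↔ StarOK (fun j => v (Fin.ofNat m j)) ψ := by
  induction ψ with
  | falsum => rfl
  | equal => rfl
  | rel => rfl
  | imp _ _ h1 h2 => simp only [star, StarOK, BoundedFormula.realize_imp, h1, h2]
  | all => rfl

variable {r : ℕ} (S : Side L K r)

/-- The definitional hypotheses evaluated on names. -/
def DefOK {M : Type} [K.Structure M] (x : ℕ → M) {n : ℕ} : Item L n → Prop
  | .tm (.var _) => True
  | .tm (.func (l := k) f ts) => ∀ f', S.fs k f = some f' →
      Structure.funMap f' (fun i => x (nmT (ts i))) = x (nmT (.func f ts))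
  | .atm (k := k) R ts => ∀ R', S.rs k R = some R' →
      (Structure.RelMap R' (fun i => x (nmT (ts i))) ↔ x (nmA R ts) = x 0)

theorem realize_defF {M : Type} [K.Structure M] (m : ℕ) [NeZero m] (e : Empty → M)
    (v : Fin m → M) {n : ℕ} (it : Item L n) :
    (∀ φ ∈ defF S m it, φ.Realize e v) ↔ DefOK S (fun j => v (Fin.ofNat m j)) it := by
  match it with
  | .tm (.var x) => simp [defF, DefOK]
  | .tm (.func (l := k) f ts) =>
    rw [defF, DefOK]
    cases hf : S.fs k f with
    | none => simp
    | some f' =>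
      simp only [List.mem_singleton, forall_eq, Option.some.injEq, forall_eq']
      rfl
  | .atm (k := k) R ts =>
    rw [defF, DefOK]
    cases hf : S.rs k R with
    | none => simp
    | some f' =>
      simp only [List.mem_cons, List.not_mem_nil, or_false, forall_eq_or_imp, forall_eq,
        Option.some.injEq, forall_eq', BoundedFormula.realize_imp]
      exact Iff.symm iff_iff_implies_and_implies

theorem realize_arrF {M : Type} [K.Structure M] (m : ℕ) [NeZero m] (e : Empty → M)
    (v : Fin m → M) (w q : ℕ) : (arrF S m w q).Realize e v ↔
      (w / 2 ^ q % 2 = 1 ↔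
        Structure.RelMap S.lt ![v (Fin.ofNat m (q / m)), v (Fin.ofNat m (q % m))]) := by
  have h : (fun i => ((fun i => vr K m (![q / m, q % m] i)) i).realize (Sum.elim e v)) =
      ![v (Fin.ofNat m (q / m)), v (Fin.ofNat m (q % m))] := by
    funext i
    refine Fin.cases rfl (fun i => ?_) i
    refine Fin.cases rfl (fun i => ?_) i
    exact i.elim0
  have h' : (BoundedFormula.rel S.lt (fun i => vr K m (![q / m, q % m] i))).Realize e v ↔
      Structure.RelMap S.lt ![v (Fin.ofNat m (q / m)), v (Fin.ofNat m (q % m))] := by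
    rw [← h]; rfl
  unfold arrF
  split_ifs with hw
  · rw [h']; simp [hw]
  · rw [BoundedFormula.realize_imp, h']
    simp only [hw, false_iff]
    rfl

/-- The meaning of failure of the test sentence. -/
theorem not_sig_iff {M : Type} [K.Structure M] (m : ℕ) [NeZero m] (w : ℕ) {n : ℕ}
    (ψ : L.BoundedFormula Empty n) :
    ¬ M ⊨ sig S m w ψ ↔ ∃ v : Fin m → M,
      (∀ i j : Fin m, w / 2 ^ (i * m + j : ℕ) % 2 = 1 ↔ Structure.RelMap S.lt ![v i, v j]) ∧
      (∀ it ∈ items ψ, DefOK S (fun j => v (Fin.ofNat m j)) it) ∧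
      ¬ StarOK (fun j => v (Fin.ofNat m j)) ψ := by
  rw [sig, Sentence.Realize, BoundedFormula.realize_alls, not_forall]
  refine exists_congr fun v => ?_
  rw [sigM, realize_impL, realize_impL, realize_star]
  simp only [List.mem_map, List.mem_range, List.mem_flatMap, forall_exists_index, and_imp,
    Classical.not_imp]
  have hm : 0 < m := Nat.pos_of_neZero m
  refine and_congr ?_ (and_congr ?_ Iff.rfl)
  · constructor
    · intro h i j
      have hq : (i * m + j : ℕ) < m * m := by
        have h1 := i.2
        have h2 := j.2
        calc (i * m + j : ℕ) < i * m + m := by omega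
          _ = (i + 1) * m := by ring
          _ ≤ m * m := Nat.mul_le_mul_right _ h1
      have := (realize_arrF S m _ v w _).1 (h _ _ hq rfl)
      have h1 : (i * m + j : ℕ) / m = i := by
        rw [mul_comm, Nat.mul_add_div hm, Nat.div_eq_of_lt j.2, add_zero]
      have h2 : (i * m + j : ℕ) % m = j := by
        rw [mul_comm, Nat.mul_add_mod, Nat.mod_eq_of_lt j.2]
      rw [h1, h2] at this
      have h3 : ∀ i : Fin m, Fin.ofNat m (i : ℕ) = i := fun i => by
        ext; simp [Fin.ofNat, Nat.mod_eq_of_lt i.2]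
      rwa [h3, h3] at this
    · rintro h φ q hq rfl
      rw [realize_arrF]
      have := h (Fin.ofNat m (q / m)) (Fin.ofNat m (q % m))
      have h1 : ((Fin.ofNat m (q / m) : Fin m) : ℕ) = q / m :=
        Nat.mod_eq_of_lt (Nat.div_lt_of_lt_mul hq)
      have h2 : ((Fin.ofNat m (q % m) : Fin m) : ℕ) = q % m :=
        Nat.mod_eq_of_lt (Nat.mod_lt _ hm)
      rwa [h1, h2, mul_comm, Nat.div_add_mod] at this
  · constructor
    · intro h it hit
      refine (realize_defF S m default v it).1 ?_
      intro φ hφ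
      exact h _ _ hit hφ
    · intro h φ it hit hφ
      exact (realize_defF S m default v it).2 (h it hit) _ hφ

/-! ### Closure of items under subterms -/

theorem self_mem_subT {n : ℕ} (t : L.Term (Empty ⊕ Fin n)) : t ∈ subT t := by
  cases t <;> simp [subT]

theorem sub_mem_subT {n k : ℕ} (s : L.Term (Empty ⊕ Fin n)) (f : L.Functions k)
    (ts : Fin k → L.Term (Empty ⊕ Fin n)) (h : Term.func f ts ∈ subT s) (i : Fin k) :
    ts i ∈ subT s := by
  induction s with
  | var => simp [subT] at h
  | func g us ih =>
    simp only [subT, List.mem_cons, List.mem_flatMap, List.mem_finRange, true_and] at h ⊢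
    rcases h with h | ⟨j, h⟩
    · cases h
      exact Or.inr ⟨i, self_mem_subT _⟩
    · exact Or.inr ⟨j, ih j h⟩

theorem items_func {n k : ℕ} (ψ : L.BoundedFormula Empty n) (f : L.Functions k)
    (ts : Fin k → L.Term (Empty ⊕ Fin n)) (h : Item.tm (.func f ts) ∈ items ψ) (i : Fin k) :
    Item.tm (ts i) ∈ items ψ := by
  induction ψ with
  | falsum => simp [items] at h
  | equal t₁ t₂ =>
    simp only [items, List.mem_append, List.mem_map, Item.tm.injEq, exists_eq_right] at h ⊢
    exact h.imp (sub_mem_subT _ _ _ · i) (sub_mem_subT _ _ _ · i)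
  | rel R us =>
    simp only [items, List.mem_cons, List.mem_flatMap, List.mem_finRange, true_and, reduceCtorEq,
      List.mem_map, Item.tm.injEq, exists_eq_right, false_or] at h ⊢
    exact h.imp (fun j hj => sub_mem_subT _ _ _ hj i)
  | imp _ _ h1 h2 =>
    simp only [items, List.mem_append] at h ⊢
    exact h.imp (h1 _ · ) (h2 _ ·)
  | all => simp [items] at h

theorem items_atm {n k : ℕ} (ψ : L.BoundedFormula Empty n) (R : L.Relations k)
    (ts : Fin k → L.Term (Empty ⊕ Fin n)) (h : Item.atm R ts ∈ items ψ) (i : Fin k) :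
    Item.tm (ts i) ∈ items ψ := by
  induction ψ with
  | falsum => simp [items] at h
  | equal t₁ t₂ => simp [items] at h
  | rel R us =>
    simp only [items, List.mem_cons, List.mem_flatMap, List.mem_finRange, true_and, reduceCtorEq,
      List.mem_map, Item.tm.injEq, exists_eq_right, false_or, and_false, exists_false,
      or_false] at h ⊢
    cases h
    exact ⟨i, self_mem_subT _⟩
  | imp _ _ h1 h2 =>
    simp only [items, List.mem_append] at h ⊢
    exact h.imp (h1 _ · ) (h2 _ ·)
  | all => simp [items] at h

theorem mem_lt_mOf (l : List ℕ) : ∀ a ∈ l, a < mOf l := by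
  intro a ha
  have : mOf l = l.sum + 1 := rfl
  have := List.le_sum_of_mem ha
  omega

/-! ### Injectivity of names -/

theorem nmT_inj {n : ℕ} (t s : L.Term (Empty ⊕ Fin n)) (h : nmT t = nmT s) : t = s := by
  induction t generalizing s with
  | var x =>
    rcases x with x | x
    · exact x.elim
    cases s with
    | var y =>
      rcases y with y | y
      · exact y.elim
      have := congrArg dl h
      rw [dl_var, dl_var] at this
      simp at this
      have : x = y := Fin.ext (by omega)
      rw [this]
    | func f ts =>
      have := congrArg dl h
      rw [dl_var, dl_func] at this
      simp at this
      omega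
  | @func k f ts ih =>
    cases s with
    | var y =>
      rcases y with y | y
      · exact y.elim
      have := congrArg dl h
      rw [dl_var, dl_func] at this
      simp at this
      omega
    | @func k' g us =>
      have := congrArg dl h
      rw [dl_func, dl_func, List.cons.injEq] at this
      obtain ⟨h1, h2⟩ := this
      have h3 : Nat.pair k (encode f) = Nat.pair k' (encode g) := by omega
      rw [Nat.pair_eq_pair] at h3
      obtain ⟨rfl, h3⟩ := h3
      have h3 := encode_injective h3
      subst h3
      congr
      funext i
      refine ih i _ ?_
      rw [List.map_inj_left] at h2
      exact h2 i (List.mem_finRange i)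

theorem nmI_inj {n : ℕ} (a b : Item L n) (h : nmI a = nmI b) : a = b := by
  have key : ∀ {k : ℕ} (t : L.Term (Empty ⊕ Fin n)) (R : L.Relations k)
      (ts : Fin k → L.Term (Empty ⊕ Fin n)), nmT t ≠ nmA R ts := by
    intro k t R ts h
    have := congrArg dl h
    rw [dl_atom] at this
    rcases t with ⟨x | x⟩ | _
    · exact x.elim
    · rw [dl_var] at this
      simp at this
    · rw [dl_func] at this
      simp at this
  cases a with
  | tm t =>
    cases b with
    | tm s => rw [nmT_inj t s h]
    | atm R ts => exact (key _ _ _ h).elim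
  | @atm k R ts =>
    cases b with
    | tm s => exact (key _ _ _ h.symm).elim
    | @atm k' R' us =>
      have := congrArg dl h
      simp only [nmI] at this
      rw [dl_atom, dl_atom, List.cons.injEq, List.cons.injEq] at this
      obtain ⟨-, h1, h2⟩ := this
      have h3 : Nat.pair k (encode R) = Nat.pair k' (encode R') := by omega
      rw [Nat.pair_eq_pair] at h3
      obtain ⟨rfl, h3⟩ := h3
      have h3 := encode_injective h3
      subst h3
      congr
      funext i
      refine nmT_inj _ _ ?_
      rw [List.map_inj_left] at h2
      exact h2 i (List.mem_finRange i)

theorem nmI_ne_zero {n : ℕ} (a : Item L n) : nmI a ≠ 0 := by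
  intro h
  have h0 : dl 0 = [] := dl_encode []
  rcases a with ⟨⟨x | x⟩ | _⟩ | _
  · exact x.elim
  · have := congrArg dl h
    simp [nmI, dl_var, h0] at this
  · have := congrArg dl h
    simp [nmI, dl_func, h0] at this
  · have := congrArg dl h
    simp [nmI, dl_atom, h0] at this

/-! ### Matrix versus flattened matrix -/

theorem starOK_iff {M : Type} [L.Structure M] (x : ℕ → M) {n : ℕ} (a : Fin n → M)
    (e : Empty → M) (ψ : L.BoundedFormula Empty n) (h : ψ.IsQF)
    (h1 : ∀ t, Item.tm t ∈ items ψ → t.realize (Sum.elim e a) = x (nmT t))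
    (h2 : ∀ (k : ℕ) (R : L.Relations k) ts, Item.atm R ts ∈ items ψ →
      (Structure.RelMap R (fun i => (ts i).realize (Sum.elim e a)) ↔ x (nmA R ts) = x 0)) :
    ψ.Realize e a ↔ StarOK x ψ := by
  induction h with
  | falsum => rfl
  | of_isAtomic h =>
    cases h with
    | equal t₁ t₂ =>
      rw [BoundedFormula.realize_bdEqual, h1 t₁, h1 t₂]
      · rfl
      all_goals simp [Term.bdEqual, items, self_mem_subT]
    | rel R ts =>
      rw [BoundedFormula.realize_rel, h2]
      · rfl
      · simp [Relations.boundedFormula, items]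
  | imp _ _ ih₁ ih₂ =>
    rw [BoundedFormula.realize_imp, StarOK, ih₁, ih₂]
    all_goals intros
    all_goals first | apply h1 | apply h2
    all_goals simp [items, *]

/-- Direction from a combined model to the two sides. -/
theorem sideA {M : Type} [L.Structure M] [Nontrivial M] {n : ℕ} (e : Empty → M) (a : Fin n → M)
    (ψ : L.BoundedFormula Empty n) (hψ : ψ.IsQF) (hn : ¬ ψ.Realize e a) (m : ℕ) [NeZero m]
    (hm : ∀ N ∈ namesF ψ, N < m) :
    ∃ v : Fin m → M, ¬ StarOK (fun j => v (Fin.ofNat m j)) ψ ∧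
      ∀ (K : FirstOrder.Language.{0, 0}) [∀ n, Encodable (K.Functions n)]
        [∀ n, Encodable (K.Relations n)] [K.Structure M] (r : ℕ) (S : Side L K r),
        (∀ k f f' (x : Fin k → M), S.fs k f = some f' →
          Structure.funMap f' x = Structure.funMap f x) →
        (∀ k f f' (x : Fin k → M), S.rs k f = some f' →
          (Structure.RelMap f' x ↔ Structure.RelMap f x)) →
        ∀ it ∈ items ψ, DefOK S (fun j => v (Fin.ofNat m j)) it := by
  classical
  obtain ⟨y, z, hyz⟩ := exists_pair_ne M
  let val : Item L n → M := fun it => match it with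
    | .tm t => t.realize (Sum.elim e a)
    | .atm R ts =>
      if Structure.RelMap R (fun i => (ts i).realize (Sum.elim e a)) then y else z
  let x : ℕ → M := fun N => if h : ∃ it : Item L n, nmI it = N then val h.choose else y
  have hx0 : x 0 = y := dif_neg (fun ⟨it, h⟩ => nmI_ne_zero it h)
  have hx : ∀ it, x (nmI it) = val it := by
    intro it
    have h : ∃ it' : Item L n, nmI it' = nmI it := ⟨it, rfl⟩
    have h2 : x (nmI it) = val h.choose := dif_pos h
    rw [h2, nmI_inj _ _ h.choose_spec]
  have hxt : ∀ t, x (nmT t) = t.realize (Sum.elim e a) := fun t => hx (.tm t)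
  have hxa : ∀ (k : ℕ) (R : L.Relations k) ts, x (nmA R ts) =
    if Structure.RelMap R (fun i => (ts i).realize (Sum.elim e a)) then y else z :=
      fun k R ts => hx (.atm R ts)
  have hxa' : ∀ (k : ℕ) (R : L.Relations k) ts, x (nmA R ts) = y ↔
      Structure.RelMap R (fun i => (ts i).realize (Sum.elim e a)) := by
    intro k R ts
    rw [hxa]
    split_ifs with h
    · simp [h]
    · simp [h, hyz.symm]
  let v : Fin m → M := fun i => x i
  have hv : ∀ it ∈ items ψ, v (Fin.ofNat m (nmI it)) = x (nmI it) := by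
    intro it hit
    change x (nmI it % m) = _
    rw [Nat.mod_eq_of_lt]
    refine hm _ ?_
    rw [names_items _ hψ]
    exact List.mem_map_of_mem hit
  have hvt : ∀ t, Item.tm t ∈ items ψ → v (Fin.ofNat m (nmT t)) = t.realize (Sum.elim e a) :=
    fun t ht => (hv _ ht).trans (hxt t)
  have hva : ∀ (k : ℕ) (R : L.Relations k) ts, Item.atm R ts ∈ items ψ →
      v (Fin.ofNat m (nmA R ts)) = x (nmA R ts) :=
    fun k R ts ht => (hv _ ht)
  have hv0 : v (Fin.ofNat m 0) = y := by
    change x (0 % m) = _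
    rw [Nat.zero_mod, hx0]
  refine ⟨v, ?_, ?_⟩
  · rw [← starOK_iff (fun j => v (Fin.ofNat m j)) a e ψ hψ]
    · exact hn
    · intro t ht
      exact (hvt t ht).symm
    · intro k R ts h
      rw [hva _ _ _ h, hv0, hxa']
  · intro K _ _ _ r S hf hr it hit
    match it, hit with
    | .tm (.var _), _ => trivial
    | .tm (.func f ts), hit =>
      intro f' hf'
      simp only
      rw [hf _ _ _ _ hf', hvt _ hit, Term.realize_func]
      congr 1
      funext i
      exact hvt _ (items_func _ _ _ hit i)
    | .atm R ts, hit =>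
      intro R' hR'
      simp only
      rw [hr _ _ _ _ hR', hva _ _ _ hit, hv0, hxa']
      have : (fun i => v (Fin.ofNat m (nmT (ts i)))) = fun i => (ts i).realize (Sum.elim e a) := by
        funext i
        exact hvt _ (items_atm _ _ _ hit i)
      rw [this]

/-- Direction from names to a combined model. -/
theorem sideB {M : Type} [L.Structure M] {n : ℕ} (e : Empty → M)
    (ψ : L.BoundedFormula Empty n) (hψ : ψ.IsQF) (x : ℕ → M) (hn : ¬ StarOK x ψ)
    (hf : ∀ k (f : L.Functions k) ts, Item.tm (.func f ts) ∈ items ψ →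
      Structure.funMap f (fun i => x (nmT (ts i))) = x (nmT (.func f ts)))
    (hr : ∀ k (R : L.Relations k) ts, Item.atm R ts ∈ items ψ →
      (Structure.RelMap R (fun i => x (nmT (ts i))) ↔ x (nmA R ts) = x 0)) :
    ∃ a : Fin n → M, ¬ ψ.Realize e a := by
  refine ⟨fun i => x (nmT (.var (.inr i) : L.Term (Empty ⊕ Fin n))), ?_⟩
  have ht : ∀ t, Item.tm t ∈ items ψ → t.realize (Sum.elim e
      (fun i => x (nmT (.var (.inr i) : L.Term (Empty ⊕ Fin n))))) = x (nmT t) := by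
    intro t
    induction t with
    | var y =>
      rcases y with y | y
      · exact y.elim
      intro _
      rfl
    | func f ts ih =>
      intro h
      rw [Term.realize_func, ← hf _ _ _ h]
      congr 1
      funext i
      exact ih i (items_func _ _ _ h i)
  rw [starOK_iff x _ e ψ hψ ht]
  · exact hn
  · intro k R ts h
    rw [← hr _ _ _ h]
    have : (fun i => (ts i).realize (Sum.elim e
      (fun i => x (nmT (.var (.inr i) : L.Term (Empty ⊕ Fin n)))))) = fun i => x (nmT (ts i)) := by
        funext i
        exact ht _ (items_atm _ _ _ h i)
    rw [this]

end sem

/-! ### Countable dense orders -/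

open Order PartialIso in
theorem iso_extending {α β : Type} [LinearOrder α] [LinearOrder β]
    [Countable α] [DenselyOrdered α] [NoMinOrder α] [NoMaxOrder α]
    [Nonempty α] [Countable β] [DenselyOrdered β] [NoMinOrder β] [NoMaxOrder β] [Nonempty β]
    {m : ℕ} (v : Fin m → α) (v' : Fin m → β) (h : ∀ i j, v i < v j ↔ v' i < v' j) :
    ∃ e : α ≃o β, ∀ i, e (v i) = v' i := by
  classical
  have hc : ∀ i j, cmp (v i) (v j) = cmp (v' i) (v' j) := by
    intro i j
    rcases lt_trichotomy (v i) (v j) with h1 | h1 | h1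
    · rw [(cmp_eq_lt_iff _ _).2 h1, (cmp_eq_lt_iff _ _).2 ((h _ _).1 h1)]
    · have : v' i = v' j := le_antisymm
        (not_lt.1 fun h2 => by
          have h3 := (h _ _).2 h2
          rw [h1] at h3
          exact lt_irrefl _ h3)
        (not_lt.1 fun h2 => by
          have h3 := (h _ _).2 h2
          rw [h1] at h3
          exact lt_irrefl _ h3)
      rw [(cmp_eq_eq_iff _ _).2 h1, (cmp_eq_eq_iff _ _).2 this]
    · rw [(cmp_eq_gt_iff _ _).2 h1, (cmp_eq_gt_iff _ _).2 ((h _ _).1 h1)]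
  let st : PartialIso α β := ⟨Finset.univ.image (fun i => (v i, v' i)), by
    intro p hp q hq
    simp only [Finset.mem_image, Finset.mem_univ, true_and] at hp hq
    obtain ⟨i, rfl⟩ := hp
    obtain ⟨j, rfl⟩ := hq
    exact hc i j⟩
  cases nonempty_encodable α
  cases nonempty_encodable β
  let to_cofinal : α ⊕ β → Cofinal (PartialIso α β) := fun p ↦
    Sum.recOn p (definedAtLeft β) (definedAtRight α)
  let our_ideal : Ideal (PartialIso α β) := idealOfCofinals st to_cofinal
  let F a := funOfIdeal a our_ideal (cofinal_meets_idealOfCofinals _ to_cofinal (Sum.inl a))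
  let G b := invOfIdeal b our_ideal (cofinal_meets_idealOfCofinals _ to_cofinal (Sum.inr b))
  refine ⟨OrderIso.ofCmpEqCmp (fun a ↦ (F a).val) (fun b ↦ (G b).val) fun a b ↦ by
      rcases (F a).prop with ⟨f, hf, ha⟩
      rcases (G b).prop with ⟨g, hg, hb⟩
      rcases our_ideal.directed _ hf _ hg with ⟨m, _, fm, gm⟩
      exact m.prop (a, _) (fm ha) (_, b) (gm hb), ?_⟩
  intro i
  change (F (v i)).val = v' i
  rcases (F (v i)).prop with ⟨f, hf, ha⟩
  have hst : st ∈ our_ideal := mem_idealOfCofinals _ _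
  rcases our_ideal.directed _ hf _ hst with ⟨m, _, fm, gm⟩
  have := m.prop (v i, _) (fm ha) (v i, v' i) (gm (Finset.mem_image_of_mem _ (Finset.mem_univ i)))
  rw [cmp_self_eq_eq] at this
  exact (cmp_eq_eq_iff _ _).1 this.symm

end

section

open FirstOrder Language Encodable

set_option linter.unusedSectionVars false

/-- A relation is a dense linear order without endpoints. -/
structure IsDLO {M : Type} (lt : M → M → Prop) : Prop where
  irrefl : ∀ a, ¬ lt a a
  trans : ∀ a b c, lt a b → lt b c → lt a c
  tri : ∀ a b, lt a b ∨ a = b ∨ lt b a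
  dense : ∀ a b, lt a b → ∃ c, lt a c ∧ lt c b
  nomin : ∀ a, ∃ b, lt b a
  nomax : ∀ a, ∃ b, lt a b

theorem isDLO_of_model {M : Type} [ordLang.Structure M] (h : M ⊨ dloTheory) :
    IsDLO (fun a b : M => Structure.RelMap (L := ordLang) (n := 2) () ![a, b]) := by
  simp only [dloTheory, Theory.model_iff, Set.mem_insert_iff, Set.mem_singleton_iff,
    forall_eq_or_imp, forall_eq, oLt] at h
  obtain ⟨h1, h2, h3, h4, h5, h6⟩ := h
  simp [Sentence.Realize, Formula.Realize, Fin.snoc] at h1 h2 h3 h4 h5 h6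
  exact ⟨h1, h2, fun a b => by simpa [or_assoc] using h3 a b, h4, h5, h6⟩

/-- The linear order attached to such a relation. -/
@[reducible] noncomputable def IsDLO.order {M : Type} {lt : M → M → Prop} (h : IsDLO lt) :
    LinearOrder M where
  le a b := lt a b ∨ a = b
  lt := lt
  le_refl a := Or.inr rfl
  le_trans a b c h1 h2 := by
    rcases h1 with h1 | rfl
    · rcases h2 with h2 | rfl
      · exact Or.inl (h.trans _ _ _ h1 h2)
      · exact Or.inl h1
    · exact h2
  lt_iff_le_not_ge a b := by
    constructor
    · intro h1
      refine ⟨Or.inl h1, ?_⟩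
      rintro (h2 | rfl)
      · exact h.irrefl _ (h.trans _ _ _ h1 h2)
      · exact h.irrefl _ h1
    · rintro ⟨h1 | rfl, h2⟩
      · exact h1
      · exact (h2 (Or.inr rfl)).elim
  le_antisymm a b h1 h2 := by
    rcases h1 with h1 | rfl
    · rcases h2 with h2 | rfl
      · exact (h.irrefl _ (h.trans _ _ _ h1 h2)).elim
      · rfl
    · rfl
  le_total a b := by
    rcases h.tri a b with h1 | h1 | h1
    · exact Or.inl (Or.inl h1)
    · exact Or.inl (Or.inr h1)
    · exact Or.inr (Or.inl h1)
  toDecidableLE := Classical.decRel _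

theorem IsDLO.infinite {M : Type} [Nonempty M] {lt : M → M → Prop} (h : IsDLO lt) :
    Infinite M := by
  let := h.order
  have : NoMaxOrder M := ⟨h.nomax⟩
  exact NoMaxOrder.infinite

theorem IsDLO.iso {M N : Type} [Nonempty M] [Nonempty N] [Countable M] [Countable N]
    {lt : M → M → Prop} (h : IsDLO lt) {lt' : N → N → Prop} (h' : IsDLO lt') {m : ℕ}
    (v : Fin m → M) (v' : Fin m → N) (hv : ∀ i j, lt (v i) (v j) ↔ lt' (v' i) (v' j)) :
    ∃ e : M ≃ N, (∀ a b, lt' (e a) (e b) ↔ lt a b) ∧ ∀ i, e (v i) = v' i := by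
  let := h.order
  let := h'.order
  have : NoMaxOrder M := ⟨h.nomax⟩
  have : NoMaxOrder N := ⟨h'.nomax⟩
  have : NoMinOrder M := ⟨h.nomin⟩
  have : NoMinOrder N := ⟨h'.nomin⟩
  have : DenselyOrdered M := ⟨h.dense⟩
  have : DenselyOrdered N := ⟨h'.dense⟩
  obtain ⟨e, he⟩ := iso_extending v v' hv
  exact ⟨e.toEquiv, fun a b => e.lt_iff_lt, he⟩

section one
variable {L' : FirstOrder.Language.{0, 0}} 

/-- The order symbol in an extension. -/
abbrev ltSym (L' : FirstOrder.Language.{0, 0}) : (ordLang.sum L').Relations 2 :=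
  Sum.inl ((() : Unit) : ordLang.Relations 2)

theorem isDLO_of_ext (T : (ordLang.sum L').Theory)
    (hdlo : ∀ φ ∈ dloTheory, T ⊨ᵇ (LHom.sumInl.onSentence φ))
    (M : Type) [(ordLang.sum L').Structure M] [M ⊨ T] [Nonempty M] :
    IsDLO (fun a b : M => Structure.RelMap (ltSym L') ![a, b]) := by
  let : ordLang.Structure M := (LHom.sumInl : ordLang →ᴸ ordLang.sum L').reduct M
  refine isDLO_of_model (M := M) ?_
  rw [Theory.model_iff]
  intro φ hφ
  exact (LHom.realize_onSentence M _ φ).1 ((hdlo φ hφ).realize_sentence M)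

theorem exists_countable_model [∀ n, Encodable (L'.Functions n)]
    [∀ n, Encodable (L'.Relations n)] (T : (ordLang.sum L').Theory)
    (hdlo : ∀ φ ∈ dloTheory, T ⊨ᵇ (LHom.sumInl.onSentence φ))
    (σ : (ordLang.sum L').Sentence) (h : ¬ T ⊨ᵇ σ) :
    ∃ (M : Type) (_ : (ordLang.sum L').Structure M), Nonempty M ∧ Countable M ∧ M ⊨ T ∧
      ¬ M ⊨ σ := by
  rw [Theory.models_sentence_iff, not_forall] at h
  obtain ⟨M, hM⟩ := h
  have := (isDLO_of_ext T hdlo M).infinite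
  have hc : (ordLang.sum L').card ≤ Cardinal.aleph0 := by
    have : Countable ((ordLang.sum L').Symbols) := by
      unfold Language.Symbols
      infer_instance
    exact Cardinal.mk_le_aleph0
  obtain ⟨N, hN, hN2⟩ := exists_elementarilyEquivalent_card_eq (ordLang.sum L') M
    Cardinal.aleph0.{0} le_rfl (by simpa using hc)
  refine ⟨N, N.str, hN.nonempty, ?_, hN.theory_model, ?_⟩
  · exact Cardinal.mk_le_aleph0_iff.1 hN2.le
  · rwa [← hN.realize_sentence]

end one

theorem symOk_even (r e : ℕ) : symOk r (2 * e) = 1 ∧ 2 * e = symVal (2 * e) := by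
  simp [symOk, symVal]

theorem symOk_ok1 (e : ℕ) :
    symOk 1 (2 * (2 * e) + 1) = 1 ∧ 2 * e + 1 = symVal (2 * (2 * e) + 1) := by
  rw [symOk, if_neg (by omega), if_pos (by omega), symVal, if_neg (by omega)]
  exact ⟨rfl, by omega⟩

theorem symOk_ok3 (e : ℕ) :
    symOk 3 (2 * (2 * e + 1) + 1) = 1 ∧ 2 * e + 1 = symVal (2 * (2 * e + 1) + 1) := by
  rw [symOk, if_neg (by omega), if_pos (by omega), symVal, if_neg (by omega)]
  exact ⟨rfl, by omega⟩

theorem symOk_no1 (e : ℕ) : symOk 1 (2 * (2 * e + 1) + 1) ≠ 1 := by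
  rw [symOk, if_neg (by omega), if_neg (by omega)]; simp

theorem symOk_no3 (e : ℕ) : symOk 3 (2 * (2 * e) + 1) ≠ 1 := by
  rw [symOk, if_neg (by omega), if_neg (by omega)]; simp

section two
variable (L₁ L₂ : FirstOrder.Language.{0, 0})
  [∀ n, Encodable (L₁.Functions n)] [∀ n, Encodable (L₁.Relations n)]
  [∀ n, Encodable (L₂.Functions n)] [∀ n, Encodable (L₂.Relations n)]

/-- The first side. -/
def side₁ : Side (ordLang.sum (L₁.sum L₂)) (ordLang.sum L₁) 1 where
  fs _ f := match f with
    | .inl f => some (.inl f)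
    | .inr (.inl f) => some (.inr f)
    | .inr (.inr _) => none
  rs _ f := match f with
    | .inl f => some (.inl f)
    | .inr (.inl f) => some (.inr f)
    | .inr (.inr _) => none
  lt := ltSym L₁
  fs_none := by
    rintro k (f | f | f) h
    · cases h
    · cases h
    · exact symOk_no1 (encode f)
  rs_none := by
    rintro k (f | f | f) h
    · cases h
    · cases h
    · exact symOk_no1 (encode f)
  fs_some := by
    rintro k (f | f | f) f' h
    · obtain rfl := Option.some.inj h
      exact symOk_even _ (encode f)
    · obtain rfl := Option.some.inj h
      exact symOk_ok1 (encode f)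
    · cases h
  rs_some := by
    rintro k (f | f | f) f' h
    · obtain rfl := Option.some.inj h
      exact symOk_even _ (encode f)
    · obtain rfl := Option.some.inj h
      exact symOk_ok1 (encode f)
    · cases h
  lt_code := rfl

/-- The second side. -/
def side₂ : Side (ordLang.sum (L₁.sum L₂)) (ordLang.sum L₂) 3 where
  fs _ f := match f with
    | .inl f => some (.inl f)
    | .inr (.inl _) => none
    | .inr (.inr f) => some (.inr f)
  rs _ f := match f with
    | .inl f => some (.inl f)
    | .inr (.inl _) => none
    | .inr (.inr f) => some (.inr f)
  lt := ltSym L₂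
  fs_none := by
    rintro k (f | f | f) h
    · cases h
    · exact symOk_no3 (encode f)
    · cases h
  rs_none := by
    rintro k (f | f | f) h
    · cases h
    · exact symOk_no3 (encode f)
    · cases h
  fs_some := by
    rintro k (f | f | f) f' h
    · obtain rfl := Option.some.inj h
      exact symOk_even _ (encode f)
    · cases h
    · obtain rfl := Option.some.inj h
      exact symOk_ok3 (encode f)
  rs_some := by
    rintro k (f | f | f) f' h
    · obtain rfl := Option.some.inj h
      exact symOk_even _ (encode f)
    · cases h
    · obtain rfl := Option.some.inj h
      exact symOk_ok3 (encode f)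
  lt_code := rfl

end two

end

section

open FirstOrder Language Encodable

set_option linter.unusedSectionVars false

theorem exists_bits (m : ℕ) (P : Fin m → Fin m → Prop) :
    ∃ w < 2 ^ (m * m), ∀ i j : Fin m, w / 2 ^ (i * m + j : ℕ) % 2 = 1 ↔ P i j := by
  classical
  rcases Nat.eq_zero_or_pos m with rfl | hm
  · exact ⟨0, by simp, fun i => i.elim0⟩
  refine ⟨Nat.ofBits (n := m * m) (fun q => decide (P ⟨q / m, Nat.div_lt_of_lt_mul q.2⟩
    ⟨q % m, Nat.mod_lt _ hm⟩)), Nat.ofBits_lt_two_pow _, ?_⟩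
  intro i j
  have hq : (i * m + j : ℕ) < m * m := by
    have h1 := i.2
    have h2 := j.2
    calc (i * m + j : ℕ) < i * m + m := by omega
      _ = (i + 1) * m := by ring
      _ ≤ m * m := Nat.mul_le_mul_right _ h1
  have h1 : (i * m + j : ℕ) / m = i := by
    rw [mul_comm, Nat.mul_add_div hm, Nat.div_eq_of_lt j.2, add_zero]
  have h2 : (i * m + j : ℕ) % m = j := by
    rw [mul_comm, Nat.mul_add_mod, Nat.mod_eq_of_lt j.2]
  have h3 := Nat.testBit_ofBits_lt (fun q : Fin (m * m) =>
    decide (P ⟨q / m, Nat.div_lt_of_lt_mul q.2⟩ ⟨q % m, Nat.mod_lt _ hm⟩)) _ hq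
  rw [Nat.testBit_eq_decide_div_mod_eq] at h3
  have h4 := Bool.eq_iff_iff.1 h3
  simp only [decide_eq_true_eq] at h4
  rw [h4]
  have h5 : (⟨(i * m + j : ℕ) / m, Nat.div_lt_of_lt_mul hq⟩ : Fin m) = i := Fin.ext h1
  have h6 : (⟨(i * m + j : ℕ) % m, Nat.mod_lt _ hm⟩ : Fin m) = j := Fin.ext h2
  rw [h5, h6]

section main
variable (L₁ L₂ : FirstOrder.Language.{0, 0})
  [∀ n, Encodable (L₁.Functions n)] [∀ n, Encodable (L₁.Relations n)]
  [∀ n, Encodable (L₂.Functions n)] [∀ n, Encodable (L₂.Relations n)]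

/-- The first inclusion of languages. -/
abbrev inc₁ : ordLang.sum L₁ →ᴸ ordLang.sum (L₁.sum L₂) :=
  LHom.sumMap (LHom.id ordLang) LHom.sumInl

/-- The second inclusion of languages. -/
abbrev inc₂ : ordLang.sum L₂ →ᴸ ordLang.sum (L₁.sum L₂) :=
  LHom.sumMap (LHom.id ordLang) LHom.sumInr

variable {L₁ L₂}

theorem dirA (T₁ : (ordLang.sum L₁).Theory) (T₂ : (ordLang.sum L₂).Theory)
    (hdlo₁ : ∀ φ ∈ dloTheory, T₁ ⊨ᵇ (LHom.sumInl.onSentence φ))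
    {n : ℕ} (ψ : (ordLang.sum (L₁.sum L₂)).BoundedFormula Empty n) (hψ : ψ.IsQF)
    (m : ℕ) [NeZero m]
    (hm : ∀ N ∈ namesF ψ, N < m)
    (h : ¬ ((inc₁ L₁ L₂).onTheory T₁ ∪ (inc₂ L₁ L₂).onTheory T₂) ⊨ᵇ
      (ψ.alls : (ordLang.sum (L₁.sum L₂)).Sentence)) :
    ∃ w < 2 ^ (m * m), ¬ T₁ ⊨ᵇ sig (side₁ L₁ L₂) m w ψ ∧ ¬ T₂ ⊨ᵇ sig (side₂ L₁ L₂) m w ψ := by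
  rw [Theory.models_sentence_iff, not_forall] at h
  obtain ⟨M, hM⟩ := h
  rw [Sentence.Realize, BoundedFormula.realize_alls, not_forall] at hM
  obtain ⟨a, ha⟩ := hM
  let _ : (ordLang.sum L₁).Structure M := (inc₁ L₁ L₂).reduct M
  let _ : (ordLang.sum L₂).Structure M := (inc₂ L₁ L₂).reduct M
  have hM := Theory.model_union_iff.1 M.is_model
  have h1 : M ⊨ T₁ := (LHom.onTheory_model (M := M) (inc₁ L₁ L₂) T₁).1 hM.1
  have h2 : M ⊨ T₂ := (LHom.onTheory_model (M := M) (inc₂ L₁ L₂) T₂).1 hM.2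
  have := (isDLO_of_ext T₁ hdlo₁ M).infinite
  obtain ⟨v, hv1, hv2⟩ := sideA default a ψ hψ ha m hm
  obtain ⟨w, hw, hw'⟩ := exists_bits m (fun i j => Structure.RelMap (ltSym L₁) ![v i, v j])
  refine ⟨w, hw, fun hs => ?_, fun hs => ?_⟩
  · refine (not_sig_iff (side₁ L₁ L₂) (M := M) m w ψ).2 ⟨v, hw', ?_, hv1⟩ (hs.realize_sentence M)
    refine hv2 _ _ _ ?_ ?_
    · rintro k (f | f | f) f' x hf
      · exact f.elim
      · obtain rfl := Option.some.inj hf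
        rfl
      · cases hf
    · rintro k (f | f | f) f' x hf
      · obtain rfl := Option.some.inj hf
        rfl
      · obtain rfl := Option.some.inj hf
        rfl
      · cases hf
  · refine (not_sig_iff (side₂ L₁ L₂) (M := M) m w ψ).2 ⟨v, hw', ?_, hv1⟩ (hs.realize_sentence M)
    refine hv2 _ _ _ ?_ ?_
    · rintro k (f | f | f) f' x hf
      · exact f.elim
      · cases hf
      · obtain rfl := Option.some.inj hf
        rfl
    · rintro k (f | f | f) f' x hf
      · obtain rfl := Option.some.inj hf
        rfl
      · cases hf
      · obtain rfl := Option.some.inj hf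
        rfl

theorem dirB (T₁ : (ordLang.sum L₁).Theory) (T₂ : (ordLang.sum L₂).Theory)
    (hdlo₁ : ∀ φ ∈ dloTheory, T₁ ⊨ᵇ (LHom.sumInl.onSentence φ))
    (hdlo₂ : ∀ φ ∈ dloTheory, T₂ ⊨ᵇ (LHom.sumInl.onSentence φ))
    {n : ℕ} (ψ : (ordLang.sum (L₁.sum L₂)).BoundedFormula Empty n) (hψ : ψ.IsQF)
    (m : ℕ) [NeZero m]
    (w : ℕ) (h₁ : ¬ T₁ ⊨ᵇ sig (side₁ L₁ L₂) m w ψ)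
    (h₂ : ¬ T₂ ⊨ᵇ sig (side₂ L₁ L₂) m w ψ) :
    ¬ ((inc₁ L₁ L₂).onTheory T₁ ∪ (inc₂ L₁ L₂).onTheory T₂) ⊨ᵇ
      (ψ.alls : (ordLang.sum (L₁.sum L₂)).Sentence) := by
  obtain ⟨M, iM, hMn, hMc, hMT, hMs⟩ := exists_countable_model T₁ hdlo₁ _ h₁
  obtain ⟨N, iN, hNn, hNc, hNT, hNs⟩ := exists_countable_model T₂ hdlo₂ _ h₂
  obtain ⟨v, hv1, hv2, hv3⟩ := (not_sig_iff _ _ _ _).1 hMs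
  obtain ⟨v', hv1', hv2', hv3'⟩ := (not_sig_iff _ _ _ _).1 hNs
  obtain ⟨e, he, hev⟩ := (isDLO_of_ext T₁ hdlo₁ M).iso (isDLO_of_ext T₂ hdlo₂ N) v v'
    (fun i j => (hv1 i j).symm.trans (hv1' i j))
  let K₂ : (ordLang.sum L₂).Structure M := e.symm.inducedStructure
  have hT₂ : M ⊨ T₂ := StrongHomClass.theory_model (e.symm.inducedStructureEquiv (L := ordLang.sum L₂))
  let iL : (ordLang.sum (L₁.sum L₂)).Structure M :=
    { funMap := fun {k} f => match f with
        | .inl f => f.elim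
        | .inr (.inl f) => iM.funMap (Sum.inr f : (ordLang.sum L₁).Functions k)
        | .inr (.inr f) => K₂.funMap (Sum.inr f : (ordLang.sum L₂).Functions k)
      RelMap := fun {k} f => match f with
        | .inl f => iM.RelMap (Sum.inl f : (ordLang.sum L₁).Relations k)
        | .inr (.inl f) => iM.RelMap (Sum.inr f : (ordLang.sum L₁).Relations k)
        | .inr (.inr f) => K₂.RelMap (Sum.inr f : (ordLang.sum L₂).Relations k) }
  have hlt : ∀ (k : ℕ) (f : ordLang.Relations k) (x : Fin k → M),
      iM.RelMap (Sum.inl f : (ordLang.sum L₁).Relations k) x ↔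
        K₂.RelMap (Sum.inl f : (ordLang.sum L₂).Relations k) x := by
    intro k f x
    match k, f with
    | 0, f => exact f.elim
    | 1, f => exact f.elim
    | _ + 3, f => exact f.elim
    | 2, f =>
      have := he (x 0) (x 1)
      have h1 : ![x 0, x 1] = x := by
        funext i
        fin_cases i <;> rfl
      have h2 : ![e (x 0), e (x 1)] = e ∘ x := by
        funext i
        fin_cases i <;> rfl
      rw [h1, h2] at this
      exact this.symm
  have hx₁ : (inc₁ L₁ L₂).IsExpansionOn M := by
    constructor
    · rintro k (f | f) x
      · exact f.elim
      · rfl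
    · rintro k (f | f) x
      · rfl
      · rfl
  have hx₂ : (inc₂ L₁ L₂).IsExpansionOn M := by
    constructor
    · rintro k (f | f) x
      · exact f.elim
      · rfl
    · rintro k (f | f) x
      · exact propext (hlt k f x)
      · rfl
  have hT : M ⊨ ((inc₁ L₁ L₂).onTheory T₁ ∪ (inc₂ L₁ L₂).onTheory T₂) :=
    Theory.model_union_iff.2 ⟨(LHom.onTheory_model (M := M) (inc₁ L₁ L₂) T₁).2 hMT,
      (LHom.onTheory_model (M := M) (inc₂ L₁ L₂) T₂).2 hT₂⟩
  intro hcon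
  have hr := hcon.realize_sentence M
  rw [Sentence.Realize, BoundedFormula.realize_alls] at hr
  have hd : ∀ it ∈ items ψ, DefOK (side₂ L₁ L₂) (M := M) (fun j => v (Fin.ofNat m j)) it := by
    have hev' : ∀ i, e.symm (v' i) = v i := fun i => by rw [← hev, Equiv.symm_apply_apply]
    intro it hit
    have := hv2' it hit
    match it, this with
    | .tm (.var _), _ => trivial
    | .tm (.func f ts), this =>
      intro f' hf'
      have h1 := this f' hf'
      simp only at h1
      change e.symm (iN.funMap f' (fun i => e (v _))) = _
      simp only [hev, h1, hev']
    | .atm R ts, this =>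
      intro R' hR'
      have h1 := this R' hR'
      simp only at h1
      change iN.RelMap R' (fun i => e (v _)) ↔ _
      simp only [hev, h1]
      rw [← hev, ← hev, e.injective.eq_iff]
  obtain ⟨a, ha⟩ := sideB default ψ hψ (fun j => v (Fin.ofNat m j)) hv3
    (by
      rintro k (f | f | f) ts h
      · exact f.elim
      · exact hv2 _ h _ rfl
      · exact hd _ h _ rfl)
    (by
      rintro k (f | f | f) ts h
      · exact hv2 _ h _ rfl
      · exact hv2 _ h _ rfl
      · exact hd _ h _ rfl)
  exact ha (hr a)

end main

theorem final (L₁ L₂ : FirstOrder.Language.{0, 0})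
    [∀ n, Encodable (L₁.Functions n)] [∀ n, Encodable (L₁.Relations n)]
    [∀ n, Encodable (L₂.Functions n)] [∀ n, Encodable (L₂.Relations n)]
    (T₁ : (ordLang.sum L₁).Theory) (T₂ : (ordLang.sum L₂).Theory)
    (hdlo₁ : ∀ φ ∈ dloTheory, T₁ ⊨ᵇ (LHom.sumInl.onSentence φ))
    (hdlo₂ : ∀ φ ∈ dloTheory, T₂ ⊨ᵇ (LHom.sumInl.onSentence φ))
    (hdec₁ : DecidableVia (univFragment T₁)) (hdec₂ : DecidableVia (univFragment T₂)) :
    DecidableVia (univFragment ((inc₁ L₁ L₂).onTheory T₁ ∪ (inc₂ L₁ L₂).onTheory T₂)) := by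
  obtain ⟨f₁, hf₁, hd₁⟩ := hdec₁
  obtain ⟨f₂, hf₂, hd₂⟩ := hdec₂
  refine ⟨combine f₁ f₂, combine_computable hf₁ hf₂, fun φ => ?_⟩
  rw [combine_iff, ← isUniversal_iff]
  refine and_congr_right ?_
  rintro ⟨n, ψ, hψ, rfl⟩
  rw [outOf_alls ψ hψ, fRun_sentence, names_alls]
  simp only
  have : NeZero (mOf (namesF ψ)) := ⟨by unfold mOf; omega⟩
  have e1 : ∀ w, f₁ (sigCode 1 (mOf (namesF ψ)) w (stream ψ) (namesF ψ)) = true ↔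
      T₁ ⊨ᵇ sig (side₁ L₁ L₂) (mOf (namesF ψ)) w ψ := by
    intro w
    rw [← encode_sig (side₁ L₁ L₂) _ w ψ hψ, ← hd₁]
    exact and_iff_right (sig_universal _ _ _ _)
  have e2 : ∀ w, f₂ (sigCode 3 (mOf (namesF ψ)) w (stream ψ) (namesF ψ)) = true ↔
      T₂ ⊨ᵇ sig (side₂ L₁ L₂) (mOf (namesF ψ)) w ψ := by
    intro w
    rw [← encode_sig (side₂ L₁ L₂) _ w ψ hψ, ← hd₂]
    exact and_iff_right (sig_universal _ _ _ _)
  simp only [e1, e2]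
  constructor
  · intro h w _
    by_contra hc
    rw [not_or] at hc
    exact dirB T₁ T₂ hdlo₁ hdlo₂ ψ hψ _ w hc.1 hc.2 h
  · intro h
    by_contra hc
    obtain ⟨w, hw, h1, h2⟩ := dirA T₁ T₂ hdlo₁ ψ hψ _ (mem_lt_mOf _) hc
    exact (h w hw).elim h1 h2

end

/-- **Theorem 3.1**: let `T₁` and `T₂` be theories extending the theory of dense linear orders
without endpoints, whose languages share only `<` (and `=`): here the language of `Tᵢ` is
`ordLang.sum Lᵢ'`, where `L₁'`, `L₂'` are the disjoint collections of extra symbols.  If the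
universal fragments of `T₁` and `T₂` are decidable, then so is the universal fragment of
`T₁ ∪ T₂`, formulated in the amalgamated language `ordLang.sum (L₁'.sum L₂')` in which the
order symbol is shared. -/
theorem nelsonOppen_dlo_decidable_univFragment_union
    (T₁ : (ordLang.sum L₁').Theory) (T₂ : (ordLang.sum L₂').Theory)
    (hdlo₁ : ∀ φ ∈ dloTheory, T₁ ⊨ᵇ (LHom.sumInl.onSentence φ))
    (hdlo₂ : ∀ φ ∈ dloTheory, T₂ ⊨ᵇ (LHom.sumInl.onSentence φ))
    (hdec₁ : DecidableVia (univFragment T₁)) (hdec₂ : DecidableVia (univFragment T₂)) :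
    DecidableVia (univFragment
      (((LHom.sumMap (LHom.id ordLang) LHom.sumInl).onTheory T₁ ∪
        (LHom.sumMap (LHom.id ordLang) LHom.sumInr).onTheory T₂ :
          (ordLang.sum (L₁'.sum L₂')).Theory))) := by
  exact final L₁' L₂' T₁ T₂ hdlo₁ hdlo₂ hdec₁ hdec₂

end

end Paper
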